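/- arXiv:2409.08085 — 2 statements merged into one kernel-verified Lean document; each statement's English description precedes it below -/
import Mathlib

section
/- For every real t > 0 and every integer n ≥ 3, the zeros of h_n(x;t) and h_{n+1}(x;t) interlace: if u_1 ≥ ... ≥ u_n are the zeros of h_{n+1}(x;t) and v_1 ≥ ... ≥ v_{n-1} are the zeros of h_n(x;t), then u_n ≤ v_{n-1} ≤ u_{n-1} ≤ ... ≤ v_1 ≤ u_1. -/
open Polynomial Finset

/-- Speyer's g-polynomial of the uniform matroid `U_{n,d}`, evaluated at `t`. -/
noncomputable def speyerG (n d : ℕ) (t : ℝ) : ℝ :=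
  ∑ i ∈ Finset.Icc 1 d,
    ((n - i - 1).choose (d - i) : ℝ) * ((n - d - 1).choose (i - 1) : ℝ) * t ^ i

/-- The generating polynomial `h_n(x;t) = ∑_{d=1}^{n-1} g_{n,d}(t) x^d` (in `x`). -/
noncomputable def hPoly (n : ℕ) (t : ℝ) : Polynomial ℝ :=
  ∑ d ∈ Finset.Icc 1 (n - 1), Polynomial.C (speyerG n d t) * Polynomial.X ^ d

/-- coefficient of `h_{m+2}/(t x)` -/
noncomputable def cc (t : ℝ) (m D : ℕ) : ℝ :=
  ∑ j ∈ Finset.range (D + 1), ((m - j).choose (D - j) : ℝ) * ((m - D).choose j : ℝ) * t ^ j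

lemma speyerG_eq (t : ℝ) (m D : ℕ) : speyerG (m + 2) (D + 1) t = t * cc t m D := by
  unfold speyerG cc
  rw [Finset.mul_sum, Finset.sum_bij' (fun i _ => i - 1) (fun j _ => j + 1)]
  · intro a ha; simp at ha ⊢; omega
  · intro a ha; simp at ha ⊢; omega
  · intro a ha; simp at ha ⊢; omega
  · intro a ha; simp at ha ⊢
  · intro a ha
    simp only [Finset.mem_Icc] at ha
    obtain ⟨b, rfl⟩ : ∃ b, a = b + 1 := ⟨a - 1, by omega⟩
    have h1 : m + 2 - (b + 1) - 1 = m - b := by omega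
    have h2 : D + 1 - (b + 1) = D - b := by omega
    have h3 : m + 2 - (D + 1) - 1 = m - D := by omega
    rw [h1, h2, h3]
    simp only [Nat.add_sub_cancel]
    ring

lemma hPoly_coeff (t : ℝ) (n k : ℕ) :
    (hPoly n t).coeff k = if 1 ≤ k ∧ k ≤ n - 1 then speyerG n k t else 0 := by
  unfold hPoly
  simp [Polynomial.coeff_X_pow]

lemma cc_rec (t : ℝ) (m E : ℕ) (h : E ≤ m) :
    cc t (m + 2) (E + 1) = cc t (m + 1) (E + 1) + cc t (m + 1) E + t * cc t m E := by
  have e : cc t (m + 1) E = (∑ i ∈ Finset.range (E + 1), (if i < E then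
      ((m + 1 - (i + 1)).choose (E - (i + 1)) : ℝ) * ((m + 1 - E).choose (i + 1) : ℝ) * t ^ (i + 1)
      else 0)) + ((m + 1).choose E : ℝ) := by
    unfold cc
    rw [Finset.sum_range_succ', Finset.sum_range_succ]
    congr 1
    · simp only [lt_irrefl, if_false, add_zero]
      apply Finset.sum_congr rfl
      intro i hi
      rw [if_pos (Finset.mem_range.1 hi)]
    · simp
  rw [e]
  unfold cc
  rw [Finset.sum_range_succ', Finset.sum_range_succ' _ (E + 1), Finset.mul_sum]
  have hp : ((m + 2 - 0).choose (E + 1 - 0) : ℝ) * ((m + 2 - (E + 1)).choose 0 : ℝ) * t ^ 0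
      = ((m + 1 - 0).choose (E + 1 - 0) : ℝ) * ((m + 1 - (E + 1)).choose 0 : ℝ) * t ^ 0
        + ((m + 1).choose E : ℝ) := by
    simp [Nat.choose_succ_succ (m + 1) E]
    ring
  rw [hp]
  have hs : ∀ i ∈ Finset.range (E + 1),
      ((m + 2 - (i + 1)).choose (E + 1 - (i + 1)) : ℝ) * ((m + 2 - (E + 1)).choose (i + 1) : ℝ)
        * t ^ (i + 1) =
      ((m + 1 - (i + 1)).choose (E + 1 - (i + 1)) : ℝ) * ((m + 1 - (E + 1)).choose (i + 1) : ℝ)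
        * t ^ (i + 1) + (if i < E then
      ((m + 1 - (i + 1)).choose (E - (i + 1)) : ℝ) * ((m + 1 - E).choose (i + 1) : ℝ) * t ^ (i + 1)
      else 0) + t * (((m - i).choose (E - i) : ℝ) * ((m - E).choose i : ℝ) * t ^ i) := by
    intro i hi
    have hi := Finset.mem_range.1 hi
    have h1 : m + 2 - (i + 1) = (m - i) + 1 := by omega
    have h2 : E + 1 - (i + 1) = E - i := by omega
    have h3 : m + 2 - (E + 1) = (m - E) + 1 := by omega
    have h4 : m + 1 - (i + 1) = m - i := by omega
    have h5 : m + 1 - (E + 1) = m - E := by omega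
    have h6 : m + 1 - E = (m - E) + 1 := by omega
    rw [h1, h2, h3, h4, h5, h6]
    split_ifs with hc
    · obtain ⟨k, hk⟩ : ∃ k, E - i = k + 1 := ⟨E - i - 1, by omega⟩
      have h7 : E - (i + 1) = k := by omega
      rw [h7, hk, Nat.choose_succ_succ, Nat.choose_succ_succ]
      push_cast
      ring
    · have h8 : E - i = 0 := by omega
      rw [h8, Nat.choose_succ_succ (m - E)]
      push_cast
      simp
      ring
  rw [Finset.sum_congr rfl hs, Finset.sum_add_distrib, Finset.sum_add_distrib]
  ring

lemma cc_zero (t : ℝ) (m : ℕ) : cc t m 0 = 1 := by simp [cc]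

lemma cc_self (t : ℝ) (m : ℕ) : cc t m m = 1 := by
  unfold cc
  rw [Finset.sum_range_succ']
  simp

lemma hPoly_coeff_zero (t : ℝ) (n : ℕ) : (hPoly n t).coeff 0 = 0 := by
  simp [hPoly_coeff]

lemma hPoly_coeff_succ (t : ℝ) (m D : ℕ) :
    (hPoly (m + 2) t).coeff (D + 1) = if D ≤ m then t * cc t m D else 0 := by
  rw [hPoly_coeff, speyerG_eq]
  congr 1
  simp

lemma hPoly_one (t : ℝ) : hPoly 1 t = 0 := by simp [hPoly]

lemma hPoly_two (t : ℝ) : hPoly 2 t = C t * X := by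
  simp [hPoly, speyerG]

lemma hPoly_three (t : ℝ) : hPoly 3 t = C t * X * (1 + X) := by
  ext k
  have : C t * X * (1 + X) = C t * X + C t * X ^ 2 := by ring
  rw [this]
  rcases k with _ | _ | _ | k
  · simp [hPoly_coeff_zero]
  · rw [hPoly_coeff_succ]; simp [cc_zero, coeff_X]
  · rw [hPoly_coeff_succ]; simp [cc_self, coeff_X]
  · rw [hPoly_coeff_succ]; simp [coeff_X, coeff_X_pow]

lemma hPoly_rec (t : ℝ) (m : ℕ) :
    hPoly (m + 4) t = (1 + X) * hPoly (m + 3) t + C t * X * hPoly (m + 2) t := by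
  have : (1 + X) * hPoly (m + 3) t + C t * X * hPoly (m + 2) t
    = hPoly (m + 3) t + X * hPoly (m + 3) t + C t * (X * hPoly (m + 2) t) := by ring
  rw [this]
  ext k
  rcases k with _ | _ | E
  · simp [hPoly_coeff_zero]
  · rw [coeff_add, coeff_add, coeff_C_mul, coeff_X_mul, coeff_X_mul,
      hPoly_coeff_succ t (m + 2), hPoly_coeff_succ t (m + 1)]
    simp [cc_zero, hPoly_coeff_zero]
  · rw [coeff_add, coeff_add, coeff_C_mul, coeff_X_mul, coeff_X_mul,
      hPoly_coeff_succ t (m + 2), hPoly_coeff_succ t (m + 1), hPoly_coeff_succ t (m + 1),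
      hPoly_coeff_succ t m]
    rcases lt_trichotomy E (m + 1) with h | h | h
    · rw [if_pos (by omega), if_pos (by omega), if_pos (by omega), if_pos (by omega),
        cc_rec t m E (by omega)]
      ring
    · subst h
      rw [if_pos (by omega), if_neg (by omega), if_pos (by omega), if_neg (by omega),
        cc_self, cc_self]
      ring
    · rw [if_neg (by omega), if_neg (by omega), if_neg (by omega), if_neg (by omega)]
      ring

lemma hPoly_rec' (t : ℝ) (m : ℕ) :
    hPoly (m + 3) t = (1 + X) * hPoly (m + 2) t + C t * X * hPoly (m + 1) t := by
  rcases m with _ | m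
  · rw [hPoly_three, hPoly_two, hPoly_one]; ring
  · exact hPoly_rec t m

/-- Chebyshev-type closed form. -/
lemma hPoly_eval_sin (t r s θ : ℝ) (hr : r ^ 2 = t * s ^ 2)
    (hs : 1 - s ^ 2 = 2 * r * Real.cos θ) (m : ℕ) :
    (hPoly (m + 1) t).eval (-s ^ 2) * Real.sin θ = -r ^ (m + 1) * Real.sin (m * θ) := by
  induction m using Nat.strong_induction_on with
  | _ m ih =>
    rcases m with _ | _ | m
    · simp [hPoly_one]
    · simp [hPoly_two, hr]
    · have a := ih m (by omega)
      have b := ih (m + 1) (by omega)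
      rw [show m + 1 + 1 + 1 = m + 3 from rfl, hPoly_rec']
      rw [show m + 1 + 1 = m + 2 from rfl] at b
      simp only [eval_add, eval_mul, eval_C, eval_X, eval_one]
      have e1 : Real.sin (((m + 1 + 1 : ℕ) : ℝ) * θ) =
          2 * Real.cos θ * Real.sin (((m + 1 : ℕ) : ℝ) * θ) - Real.sin (m * θ) := by
        have p : ((m + 1 + 1 : ℕ) : ℝ) * θ = ((m + 1 : ℕ) : ℝ) * θ + θ := by push_cast; ring
        have q : (m : ℝ) * θ = ((m + 1 : ℕ) : ℝ) * θ - θ := by push_cast; ring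
        rw [p, q, Real.sin_add, Real.sin_sub]; ring
      rw [e1]
      have : ((1 + -s ^ 2) * eval (-s ^ 2) (hPoly (m + 2) t) +
          t * -s ^ 2 * eval (-s ^ 2) (hPoly (m + 1) t)) * Real.sin θ =
          (1 - s ^ 2) * (eval (-s ^ 2) (hPoly (m + 2) t) * Real.sin θ)
          - (t * s ^ 2) * (eval (-s ^ 2) (hPoly (m + 1) t) * Real.sin θ) := by ring
      rw [this, a, b, hs, ← hr]
      ring

noncomputable def sF (t c : ℝ) : ℝ := Real.sqrt (t * c ^ 2 + 1) - Real.sqrt t * c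

lemma sF_sq (t : ℝ) (ht : 0 < t) (c : ℝ) :
    1 - sF t c ^ 2 = 2 * (Real.sqrt t * sF t c) * c := by
  unfold sF
  have h1 := Real.sq_sqrt ht.le
  have h2 : Real.sqrt (t * c ^ 2 + 1) ^ 2 = t * c ^ 2 + 1 := Real.sq_sqrt (by positivity)
  generalize Real.sqrt (t * c ^ 2 + 1) = A at *
  generalize Real.sqrt t = B at *
  linear_combination -h2 + c ^ 2 * h1

lemma sF_pos (t : ℝ) (ht : 0 < t) (c : ℝ) : 0 < sF t c := by
  unfold sF
  have h1 := Real.sq_sqrt ht.le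
  rw [sub_pos]
  apply Real.lt_sqrt_of_sq_lt
  rw [mul_pow, h1]; linarith

lemma sF_anti (t : ℝ) (ht : 0 < t) {c d : ℝ} (h : c < d) : sF t d < sF t c := by
  by_contra hc
  push Not at hc
  have a := sF_sq t ht c
  have b := sF_sq t ht d
  have pc := sF_pos t ht c
  have pd := sF_pos t ht d
  have pt := Real.sqrt_pos.2 ht
  have e : ∀ c, 0 < sF t c → 1 - sF t c ^ 2 = 2 * (Real.sqrt t * sF t c) * c →
      1 / sF t c - sF t c = 2 * Real.sqrt t * c := by
    intro c p h
    field_simp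
    linarith
  have aa2 := e c pc a
  have bb2 := e d pd b
  have : 1 / sF t d ≤ 1 / sF t c := one_div_le_one_div_of_le pc hc
  nlinarith

/-- the explicit zeros -/
noncomputable def RR (t : ℝ) (m k : ℕ) : ℝ :=
  if k = 0 then 0 else -(sF t (Real.cos (k * Real.pi / m))) ^ 2

lemma RR_root (t : ℝ) (ht : 0 < t) (m k : ℕ) (hk : k < m) :
    (hPoly (m + 1) t).eval (RR t m k) = 0 := by
  unfold RR
  split_ifs with h
  · rw [← coeff_zero_eq_eval_zero, hPoly_coeff_zero]
  · have hm : (0 : ℝ) < m := by exact_mod_cast (by omega : 0 < m)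
    have hk0 : (0 : ℝ) < k := by exact_mod_cast (by omega : 0 < k)
    have hkm : (k : ℝ) < m := by exact_mod_cast hk
    set θ := (k : ℝ) * Real.pi / m with hθ
    have key := hPoly_eval_sin t (Real.sqrt t * sF t (Real.cos θ)) (sF t (Real.cos θ)) θ
      (by rw [mul_pow, Real.sq_sqrt ht.le]) (sF_sq t ht _) m
    have hz : Real.sin (m * θ) = 0 := by
      have : (m : ℝ) * θ = k * Real.pi := by rw [hθ]; field_simp
      rw [this, Real.sin_nat_mul_pi]
    have hp : 0 < Real.sin θ := by
      apply Real.sin_pos_of_pos_of_lt_pi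
      · have := Real.pi_pos; positivity
      · rw [hθ, div_lt_iff₀ hm]; nlinarith [Real.pi_pos]
    rw [hz, mul_zero] at key
    exact (mul_eq_zero.1 key).resolve_right hp.ne'

lemma RR_lt (t : ℝ) (ht : 0 < t) (m k mm2 kk2 : ℕ) (hk2 : kk2 < mm2) (hm : 0 < m)
    (h0 : 0 < kk2) (h : k * mm2 < kk2 * m) : RR t mm2 kk2 < RR t m k := by
  unfold RR
  rw [if_neg h0.ne']
  split_ifs with h1
  · have := sF_pos t ht (Real.cos (kk2 * Real.pi / mm2))
    have := pow_pos this 2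
    linarith
  · have hm0 : (0 : ℝ) < m := by exact_mod_cast hm
    have hm1 : (0 : ℝ) < mm2 := by exact_mod_cast (by omega : 0 < mm2)
    have hr : (k : ℝ) * mm2 < kk2 * m := by exact_mod_cast h
    have hkr : (kk2 : ℝ) < mm2 := by exact_mod_cast hk2
    have hc : Real.cos (kk2 * Real.pi / mm2) < Real.cos (k * Real.pi / m) := by
      apply Real.cos_lt_cos_of_nonneg_of_le_pi
      · have := Real.pi_pos; positivity
      · rw [div_le_iff₀ hm1]; nlinarith [Real.pi_pos]
      · rw [div_lt_div_iff₀ hm0 hm1]; nlinarith [Real.pi_pos]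
    have := sF_anti t ht hc
    have := pow_lt_pow_left₀ this (sF_pos t ht _).le two_ne_zero
    linarith

lemma roots_explicit (t : ℝ) (ht : 0 < t) (m : ℕ) (hm : 0 < m) (u : Fin m → ℝ) (hu : Antitone u)
    (hroots : (hPoly (m + 1) t).roots = Multiset.map u Finset.univ.val) (i : Fin m) :
    u i = RR t m i := by
  have hsa : StrictAnti (fun i : Fin m => RR t m i) := by
    intro i j hij
    have : i.1 < j.1 := hij
    exact RR_lt t ht m i m j j.2 hm (by omega) (Nat.mul_lt_mul_of_pos_right this hm)
  have hne : hPoly (m + 1) t ≠ 0 := by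
    intro h
    rw [h, roots_zero] at hroots
    have := congrArg Multiset.card hroots
    simp at this
    omega
  have hle : Multiset.map (fun i : Fin m => RR t m i) Finset.univ.val ≤ (hPoly (m + 1) t).roots := by
    rw [Multiset.le_iff_subset (Multiset.Nodup.map hsa.injective Finset.univ.nodup)]
    intro x hx
    obtain ⟨i, -, rfl⟩ := Multiset.mem_map.1 hx
    exact (mem_roots hne).2 (RR_root t ht m i i.2)
  rw [hroots] at hle
  have heq := Multiset.eq_of_le_of_card_le hle (by simp)
  rw [Fin.univ_val_map, Fin.univ_val_map, Multiset.coe_eq_coe] at heq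
  have := heq.eq_of_sortedGE hsa.antitone.sortedGE_ofFn hu.sortedGE_ofFn
  exact (congrFun (List.ofFn_injective this) i).symm



theorem hPoly_interlacing (t : ℝ) (ht : 0 < t) (n : ℕ) (hn : 3 ≤ n)
    (u : Fin n → ℝ) (v : Fin (n - 1) → ℝ)
    (hu : Antitone u) (hv : Antitone v)
    (huroots : (hPoly (n + 1) t).roots = Multiset.map u Finset.univ.val)
    (hvroots : (hPoly n t).roots = Multiset.map v Finset.univ.val) :
    ∀ i : Fin (n - 1),
      u ⟨i.1 + 1, by have := i.isLt; omega⟩ ≤ v i ∧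
      v i ≤ u ⟨i.1, by have := i.isLt; omega⟩ := by
  intro i
  obtain ⟨m, rfl⟩ : ∃ m, n = m + 1 := ⟨n - 1, by omega⟩
  have hi : i.1 < m := i.2
  rw [roots_explicit t ht (m + 1) (by omega) u hu huroots,
    roots_explicit t ht (m + 1) (by omega) u hu huroots,
    roots_explicit t ht m (by omega) v hv hvroots]
  constructor
  · exact (RR_lt t ht m i (m + 1) (i + 1) (by omega) (by omega) (by omega) (by nlinarith)).le
  · rcases Nat.eq_zero_or_pos i.1 with h | h
    · simp only [h]
      simp [RR]
    · exact (RR_lt t ht (m + 1) i m i hi (by omega) h (by nlinarith)).le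
end

section
/- If a polynomial ∑_{k=0}^n a_k x^k with real coefficients has only real and negative zeros, then the sequence (a_0, ..., a_n) is infinitely log-concave; that is, every iterate of the operator L, defined by L((a_k))_k = (a_k² − a_{k-1}a_{k+1})_k with a_{-1} = a_{n+1} = 0, yields a nonnegative sequence. -/
open Polynomial Finset

/-- The log-concavity operator `L` on sequences, with the convention `a_{-1} = 0`. -/
noncomputable def logConcOp (a : ℕ → ℝ) : ℕ → ℝ :=
  fun k => a k ^ 2 - (if k = 0 then 0 else a (k - 1)) * a (k + 1)


/-- The polynomial `y ↦ E ((y + X) ^ N)`. -/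
noncomputable def momentPoly (E : ℂ[X] →ₗ[ℂ] ℂ) (N : ℕ) : ℂ[X] :=
  ∑ m ∈ range (N + 1), C (E (X ^ (N - m)) * (N.choose m : ℂ)) * X ^ m

lemma momentPoly_eval (E : ℂ[X] →ₗ[ℂ] ℂ) (N : ℕ) (y : ℂ) :
    (momentPoly E N).eval y = E ((C y + X) ^ N) := by
  rw [add_pow, map_sum, momentPoly, eval_finsetSum]
  refine sum_congr rfl fun m _ => ?_
  have : (C y ^ m * X ^ (N - m) * ((N.choose m : ℕ) : ℂ[X])) =
      (y ^ m * (N.choose m : ℂ)) • (X ^ (N - m) : ℂ[X]) := by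
    rw [smul_eq_C_mul]; simp; ring
  rw [this, map_smul]
  simp; ring

lemma momentPoly_coeff (E : ℂ[X] →ₗ[ℂ] ℂ) (N m : ℕ) :
    (momentPoly E N).coeff m = E (X ^ (N - m)) * (N.choose m : ℂ) := by
  simp only [momentPoly, finsetSum_coeff, coeff_C_mul, coeff_X_pow, mul_ite, mul_one, mul_zero,
    Finset.sum_ite_eq, mem_range]
  split_ifs with h
  · rfl
  · rw [Nat.choose_eq_zero_of_lt (by omega)]; simp

lemma momentPoly_derivative (E : ℂ[X] →ₗ[ℂ] ℂ) (N : ℕ) :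
    derivative (momentPoly E (N + 1)) = C ((N : ℂ) + 1) * momentPoly E N := by
  ext m
  rw [coeff_derivative, coeff_C_mul, momentPoly_coeff, momentPoly_coeff]
  have := Nat.add_one_mul_choose_eq N m
  have h2 : ((N : ℂ) + 1) * (N.choose m : ℂ) = ((N + 1).choose (m + 1) : ℂ) * ((m : ℂ) + 1) := by
    exact_mod_cast this
  rw [Nat.add_sub_add_right]
  linear_combination (-E (X ^ (N - m))) * h2

lemma disc_of_re {σ : ℝ} (hσ : 0 < σ) {w : ℂ} (hw : σ ≤ w.re) :
    ‖1 / w - ((1 / (2 * σ) : ℝ) : ℂ)‖ ≤ 1 / (2 * σ) := by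
  have hw0 : w ≠ 0 := by rintro rfl; simp at hw; linarith
  have hσ' : (σ : ℂ) ≠ 0 := by exact_mod_cast hσ.ne'
  have : 1 / w - ((1 / (2 * σ) : ℝ) : ℂ) = (2 * σ - w) / (2 * σ * w) := by
    push_cast; field_simp
  rw [this, norm_div, norm_mul]
  have h1 : ‖(2 * σ : ℂ)‖ = 2 * σ := by
    rw [norm_mul]; simp [abs_of_pos hσ]
  rw [h1, div_le_div_iff₀ (by positivity) (by positivity)]
  have : ‖(2 * σ - w : ℂ)‖ ≤ ‖w‖ := by
    rw [Complex.norm_def, Complex.norm_def]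
    apply Real.sqrt_le_sqrt
    simp [Complex.normSq_apply]
    nlinarith
  nlinarith

lemma re_of_disc {σ : ℝ} (hσ : 0 < σ) {w : ℂ} (hw0 : w ≠ 0)
    (hw : ‖1 / w - ((1 / (2 * σ) : ℝ) : ℂ)‖ ≤ 1 / (2 * σ)) : σ ≤ w.re := by
  have hσ' : (σ : ℂ) ≠ 0 := by exact_mod_cast hσ.ne'
  have : 1 / w - ((1 / (2 * σ) : ℝ) : ℂ) = (2 * σ - w) / (2 * σ * w) := by
    push_cast; field_simp
  have h1 : ‖(2 * σ : ℂ)‖ = 2 * σ := by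
    rw [norm_mul]; simp [abs_of_pos hσ]
  have hwp : 0 < ‖w‖ := norm_pos_iff.2 hw0
  rw [this, norm_div, norm_mul, h1, div_le_div_iff₀ (by positivity) (by positivity)] at hw
  have : ‖(2 * σ - w : ℂ)‖ ≤ ‖w‖ := by
    nlinarith
  rw [Complex.norm_def, Complex.norm_def, Real.sqrt_le_sqrt_iff (Complex.normSq_nonneg _)] at this
  simp [Complex.normSq_apply] at this
  nlinarith

lemma norm_sum_sub_le (s : Multiset ℂ) (f : ℂ → ℂ) (c : ℂ) (d : ℝ)
    (h : ∀ r ∈ s, ‖f r - c‖ ≤ d) : ‖(s.map f).sum - s.card * c‖ ≤ s.card * d := by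
  induction s using Multiset.induction_on with
  | empty => simp
  | cons a s ih =>
    have h1 := h a (by simp)
    have h2 := ih fun r hr => h r (by simp [hr])
    simp only [Multiset.map_cons, Multiset.sum_cons, Multiset.card_cons]
    push_cast
    calc _ = ‖(f a - c) + ((s.map f).sum - s.card * c)‖ := by congr 1; ring
      _ ≤ _ := norm_add_le _ _
      _ ≤ _ := by linarith

lemma gws (n : ℕ) : ∀ (E : ℂ[X] →ₗ[ℂ] ℂ), E 1 ≠ 0 →
    (∀ y : ℂ, 0 < y.re → E ((C y + X) ^ n) ≠ 0) →
    ∀ s : Multiset ℂ, s.card = n → (∀ y ∈ s, 0 < y.re) →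
      E ((s.map fun y => C y + X).prod) ≠ 0 := by
  induction n with
  | zero =>
    intro E h1 _ s hs _
    rw [Multiset.card_eq_zero] at hs
    subst hs
    simpa using h1
  | succ n ih =>
    intro E h1 h2 s hs hpos
    obtain ⟨ζ, t, rfl⟩ : ∃ ζ t, s = ζ ::ₘ t := by
      have := Multiset.card_pos_iff_exists_mem.1 (by omega : 0 < s.card)
      obtain ⟨ζ, hζ⟩ := this
      exact ⟨ζ, _, (Multiset.cons_erase hζ).symm⟩
    have hζ : 0 < ζ.re := hpos ζ (by simp)
    set G := momentPoly E (n + 1) with hG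
    have hnC : ((n : ℂ) + 1) ≠ 0 := by exact_mod_cast Nat.succ_ne_zero n
    have hlc : G.coeff (n + 1) = E 1 := by simp [hG, momentPoly_coeff]
    have hdeg : G.natDegree = n + 1 := by
      refine natDegree_eq_of_le_of_coeff_ne_zero ?_ (by rw [hlc]; exact h1)
      rw [natDegree_le_iff_coeff_eq_zero]
      intro m hm
      rw [hG, momentPoly_coeff, Nat.choose_eq_zero_of_lt hm]; simp
    have hG0 : G ≠ 0 := by intro h; rw [h] at hdeg; simp at hdeg
    have hsp : G.Splits := IsAlgClosed.splits G
    have hcard : G.roots.card = n + 1 := by rw [← hsp.natDegree_eq_card_roots, hdeg]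
    have hroots : ∀ r ∈ G.roots, r.re ≤ 0 := by
      intro r hr
      by_contra! h
      apply h2 r h
      rw [← momentPoly_eval]
      exact (mem_roots hG0).1 hr
    have key := ih (E ∘ₗ LinearMap.mulLeft ℂ (C ζ + X)) ?_ ?_ t (by simpa using hs)
      (fun y hy => hpos y (by simp [hy]))
    · simpa using key
    · -- total mass
      intro h0
      have h0' : ζ * E 1 + E X = 0 := by
        have : C ζ + X = ζ • (1 : ℂ[X]) + X := by rw [smul_eq_C_mul, mul_one]
        simpa [this] using h0
      have hnc := hsp.nextCoeff_eq_neg_sum_roots_mul_leadingCoeff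
      rw [nextCoeff_of_natDegree_pos (by omega), leadingCoeff, hdeg, hlc, Nat.add_sub_cancel, hG,
        momentPoly_coeff, ← hG] at hnc
      have e1 : (n + 1 - n) = 1 := by omega
      rw [e1, pow_one, Nat.choose_succ_self_right] at hnc
      push_cast at hnc
      have hsum : G.roots.sum = ((n : ℂ) + 1) * ζ := by
        apply mul_left_cancel₀ h1
        linear_combination hnc - ((n : ℂ) + 1) * h0'
      have hre : ∀ s : Multiset ℂ, (∀ r ∈ s, r.re ≤ 0) → s.sum.re ≤ 0 := by
        intro s
        induction s using Multiset.induction_on with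
        | empty => simp
        | cons a s ih =>
          intro h
          have h1 := h a (by simp)
          have h2 := ih fun r hr => h r (by simp [hr])
          simp only [Multiset.sum_cons, Complex.add_re]
          linarith
      have := hre _ hroots
      rw [hsum] at this
      have e2 : (((n : ℂ) + 1) * ζ).re = ((n : ℝ) + 1) * ζ.re := by
        simp
      rw [e2] at this
      have : (0 : ℝ) < ((n : ℝ) + 1) * ζ.re := by positivity
      linarith
    · intro y hy h0
      have hGy : G.eval y ≠ 0 := by rw [hG, momentPoly_eval]; exact h2 y hy
      have hd := hsp.eval_derivative_div_eval_of_ne_zero hGy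
      have hd' : G.derivative.eval y = ((n : ℂ) + 1) * E ((C y + X) ^ n) := by
        rw [hG, momentPoly_derivative, eval_mul, eval_C, momentPoly_eval]
      have h0' : G.eval y + (ζ - y) * E ((C y + X) ^ n) = 0 := by
        rw [hG, momentPoly_eval, ← smul_eq_mul, ← map_smul, ← map_add, ← h0]
        simp only [LinearMap.comp_apply, LinearMap.mulLeft_apply]
        congr 1
        rw [smul_eq_C_mul, C_sub]; ring
      set S := (G.roots.map fun z ↦ 1 / (y - z)).sum with hS
      have hbound := norm_sum_sub_le G.roots (fun z ↦ 1 / (y - z)) ((1 / (2 * y.re) : ℝ) : ℂ)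
        (1 / (2 * y.re)) (by
          intro r hr
          apply disc_of_re hy
          have := hroots r hr
          simp; linarith)
      rw [← hS, hcard] at hbound
      have hyz : y - ζ ≠ 0 := by
        intro h
        have : ζ - y = 0 := by linear_combination -h
        rw [this] at h0'
        apply hGy
        simpa using h0'
      have hSeq : S = ((n : ℂ) + 1) * (1 / (y - ζ)) := by
        rw [← hd, hd']
        field_simp
        linear_combination (-1) * h0'
      rw [hSeq] at hbound
      push_cast at hbound
      rw [← mul_sub, norm_mul] at hbound
      have e3 : ‖((n : ℂ) + 1)‖ = (n : ℝ) + 1 := by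
        have : ((n : ℂ) + 1) = ((n + 1 : ℕ) : ℂ) := by push_cast; rfl
        rw [this, Complex.norm_natCast]; push_cast; rfl
      rw [e3] at hbound
      have hb2 := le_of_mul_le_mul_left hbound (by positivity)
      have := re_of_disc hy hyz (by push_cast; exact hb2)
      simp at this
      linarith

open LaurentPolynomial in
/-- `f ↦` constant term of `(1 - z ^ 2) f`. -/
noncomputable def ctFun : LaurentPolynomial ℂ →ₗ[ℂ] ℂ where
  toFun f := ((1 - T 2) * f).coeff 0
  map_add' f g := by rw [mul_add]; rfl
  map_smul' c f := by rw [mul_smul_comm]; rfl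

open LaurentPolynomial in
lemma ctFun_T (k : ℤ) : ctFun (T k) = (if k = 0 then 1 else 0) - (if k = -2 then 1 else 0) := by
  have : ((1 - T 2) * T k : LaurentPolynomial ℂ) = T k - T (2 + k) := by
    rw [sub_mul, one_mul, T_add]
  show ((1 - T 2) * T k : LaurentPolynomial ℂ).coeff 0 = _
  rw [this]
  simp only [T, AddMonoidAlgebra.coeff_sub, Finsupp.sub_apply, AddMonoidAlgebra.coeff_single, Finsupp.single_apply]
  congr 1
  by_cases h : k = -2
  · simp [h]
  · rw [if_neg (by omega), if_neg h]

open LaurentPolynomial in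
/-- The semicircle functional. -/
noncomputable def semiFun : ℂ[X] →ₗ[ℂ] ℂ :=
  ctFun ∘ₗ (aeval (T 1 + T (-1) : LaurentPolynomial ℂ)).toLinearMap

lemma semiFun_one : semiFun 1 = 1 := by
  have := ctFun_T 0
  rw [LaurentPolynomial.T_zero] at this
  simp [semiFun, this]

/-- Complex version of the operator. -/
noncomputable def logConcC (a : ℕ → ℂ) : ℕ → ℂ :=
  fun k => a k ^ 2 - (if k = 0 then 0 else a (k - 1)) * a (k + 1)

open LaurentPolynomial in
lemma aeval_monoSum (n : ℕ) (a : ℕ → ℂ) (ξ : ℂ) (m : ℤ) :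
    aeval (ξ • T m : LaurentPolynomial ℂ) (∑ k ∈ range (n + 1), Polynomial.C (a k) * X ^ k) =
      ∑ k ∈ range (n + 1), (a k * ξ ^ k) • T (k * m) := by
  rw [map_sum]
  refine sum_congr rfl fun k _ => ?_
  rw [map_mul, aeval_C, map_pow, aeval_X, _root_.smul_pow, T_pow, ← Algebra.smul_def, smul_smul]

open LaurentPolynomial in
lemma ctFun_prod (n : ℕ) (a : ℕ → ℂ) (hs : ∀ k, n < k → a k = 0) (ξ : ℂ) (P : ℂ[X])
    (hP : P = ∑ k ∈ range (n + 1), Polynomial.C (a k) * X ^ k) :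
    ctFun (aeval (ξ • T 1 : LaurentPolynomial ℂ) P * aeval (ξ • T (-1) : LaurentPolynomial ℂ) P) =
      ∑ k ∈ range (n + 1), logConcC a k * (ξ ^ 2) ^ k := by
  rw [hP, aeval_monoSum, aeval_monoSum, sum_mul_sum, map_sum]
  have h1 : ∀ i ∈ range (n + 1), ctFun (∑ j ∈ range (n + 1),
      ((a i * ξ ^ i) • T (i * 1 : ℤ)) * ((a j * ξ ^ j) • T (j * (-1) : ℤ))) =
      a i ^ 2 * (ξ ^ 2) ^ i - a i * a (i + 2) * (ξ ^ 2) ^ (i + 1) := by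
    intro i hi
    rw [map_sum]
    have h2 : ∀ j ∈ range (n + 1), ctFun
      (((a i * ξ ^ i) • T (i * 1 : ℤ)) * ((a j * ξ ^ j) • T (j * (-1) : ℤ)) ) =
      (if i = j then (a i * ξ ^ i) * (a j * ξ ^ j) else 0) -
       (if i + 2 = j then (a i * ξ ^ i) * (a j * ξ ^ j) else 0) := by
      intro j _
      rw [smul_mul_smul_comm, ← T_add, map_smul, ctFun_T, smul_eq_mul, mul_sub, mul_ite, mul_ite]
      simp only [mul_one, mul_zero]
      congr 1
      · congr 1; simp only [eq_iff_iff]; omega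
      · congr 1; simp only [eq_iff_iff]; omega
    rw [sum_congr rfl h2, sum_sub_distrib, Finset.sum_ite_eq, Finset.sum_ite_eq, if_pos hi]
    have h3 : (if i + 2 ∈ range (n + 1) then a i * ξ ^ i * (a (i + 2) * ξ ^ (i + 2)) else 0) =
        a i * ξ ^ i * (a (i + 2) * ξ ^ (i + 2)) := by
      split_ifs with h
      · rfl
      · rw [hs (i + 2) (by simp at h; omega)]; ring
    rw [h3]; ring
  rw [sum_congr rfl h1, sum_sub_distrib]
  simp only [logConcC, sub_mul, sum_sub_distrib]
  congr 1
  rw [sum_range_succ, sum_range_succ' _ n, hs (n + 2) (by omega)]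
  simp

open LaurentPolynomial in
lemma core_identity (n : ℕ) (a : ℕ → ℂ) (hs : ∀ k, n < k → a k = 0) (ξ : ℂ) (hξ : ξ ≠ 0)
    (c : ℂ) (s : Multiset ℂ) (h0 : ∀ r ∈ s, r ≠ 0)
    (hP : ∑ k ∈ range (n + 1), Polynomial.C (a k) * X ^ k =
      Polynomial.C c * (s.map fun r => X - Polynomial.C r).prod) :
    ∑ k ∈ range (n + 1), logConcC a k * (ξ ^ 2) ^ k =
      c ^ 2 * (s.map fun r => -r * ξ).prod *
        semiFun (((s.map fun r => ξ / (-r) + (-r) / ξ).map fun y => Polynomial.C y + X).prod) := by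
  rw [← ctFun_prod n a hs ξ _ rfl, hP]
  have key : aeval (ξ • T 1 : LaurentPolynomial ℂ) (s.map fun r => X - Polynomial.C r).prod *
      aeval (ξ • T (-1) : LaurentPolynomial ℂ) (s.map fun r => X - Polynomial.C r).prod =
      (s.map fun r => -r * ξ).prod • aeval (T 1 + T (-1) : LaurentPolynomial ℂ)
      (((s.map fun r => ξ / (-r) + (-r) / ξ).map fun y => Polynomial.C y + X).prod) := by
    clear hP
    induction s using Multiset.induction_on with
    | empty => simp
    | cons r s ih =>
      have ih' := ih fun r hr => h0 r (by simp [hr])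
      have hr : r ≠ 0 := h0 r (by simp)
      simp only [Multiset.map_cons, Multiset.prod_cons, map_mul]
      rw [mul_mul_mul_comm, ih', ← smul_mul_smul_comm, mul_smul_comm, mul_smul_comm]
      congr 1
      congr 1
      have hT : (T 1 * T (-1) : LaurentPolynomial ℂ) = 1 := by rw [← T_add]; simp
      rw [map_sub, map_sub, map_add (aeval _), aeval_X, aeval_C, aeval_X, aeval_C, aeval_X, aeval_C]
      have e : (-r * ξ) * (ξ / (-r) + (-r) / ξ) = ξ ^ 2 + r ^ 2 := by
        field_simp
        ring
      rw [smul_add, Algebra.smul_def (-r * ξ) (algebraMap _ _ _), ← map_mul, e]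
      simp only [Algebra.smul_def, map_add, map_mul, map_pow, map_neg]
      linear_combination (algebraMap ℂ (LaurentPolynomial ℂ) ξ) ^ 2 * hT
  rw [map_mul (aeval _), map_mul (aeval _), mul_mul_mul_comm, key, aeval_C, aeval_C, ← map_mul, ← Algebra.smul_def,
    smul_smul, map_smul, smul_eq_mul, semiFun, LinearMap.comp_apply, AlgHom.toLinearMap_apply]
  ring

lemma roots_derivative_mem {S : Set ℂ} (hS : Convex ℝ S) (P : ℂ[X]) (m : ℕ)
    (hm : m < P.natDegree) (h : ∀ z, P.eval z = 0 → z ∈ S) :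
    (derivative^[m] P).natDegree = P.natDegree - m ∧
      ∀ z, (derivative^[m] P).eval z = 0 → z ∈ S := by
  induction m with
  | zero => simpa using h
  | succ m ih =>
    obtain ⟨h1, h2⟩ := ih (by omega)
    set Q := derivative^[m] P
    have hd : 0 < Q.natDegree := by omega
    have hd' : 0 < Q.degree := natDegree_pos_iff_degree_pos.1 hd
    have hQ' : (derivative Q).natDegree = Q.natDegree - 1 := natDegree_derivative Q
    rw [Function.iterate_succ_apply']
    change (derivative Q).natDegree = _ ∧ ∀ z, (derivative Q).eval z = 0 → z ∈ S
    refine ⟨by omega, fun z hz => ?_⟩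
    have hne : derivative Q ≠ 0 := by
      intro h0
      rw [h0] at hQ'
      simp at hQ'
      omega
    have := rootSet_derivative_subset_convexHull_rootSet hd'
      (show z ∈ (derivative Q).rootSet ℂ by
        rw [mem_rootSet]; exact ⟨hne, by simpa using hz⟩)
    refine convexHull_min ?_ hS this
    intro w hw
    rw [mem_rootSet] at hw
    exact h2 w (by simpa using hw.2)

lemma choose_identity (n k : ℕ) : ((n : ℂ) + 1) *
    ((n.choose k : ℂ) ^ 2 - (if k = 0 then 0 else (n.choose (k - 1) : ℂ)) * (n.choose (k + 1) : ℂ))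
      = ((n + 1).choose k : ℂ) * ((n + 1).choose (k + 1) : ℂ) := by
  rcases k with _ | j
  · simp
  · simp only [Nat.add_sub_cancel, Nat.add_eq_zero_iff, one_ne_zero, and_false, if_false]
    rw [Nat.choose_succ_succ n j, Nat.choose_succ_succ n (j + 1)]
    have h1 : (n.choose (j + 1) : ℂ) * (j + 1) = n.choose j * (n - j) := by
      have := Nat.choose_succ_right_eq n j
      rcases le_or_gt j n with h | h
      · rw [← Nat.cast_sub h]; exact_mod_cast this
      · rw [Nat.choose_eq_zero_of_lt h, Nat.choose_eq_zero_of_lt (by omega)]; simp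
    have h2 : (n.choose (j + 1 + 1) : ℂ) * (j + 2) = n.choose (j + 1) * (n - (j + 1)) := by
      have := Nat.choose_succ_right_eq n (j + 1)
      rcases le_or_gt (j + 1) n with h | h
      · have e : ((n : ℂ) - (j + 1)) = ((n - (j + 1) : ℕ) : ℂ) := by rw [Nat.cast_sub h]; simp
        rw [e]; exact_mod_cast this
      · rw [Nat.choose_eq_zero_of_lt h, Nat.choose_eq_zero_of_lt (by omega)]; simp
    have hj1 : ((j : ℂ) + 1) ≠ 0 := by exact_mod_cast Nat.succ_ne_zero j
    have hj2 : ((j : ℂ) + 2) ≠ 0 := by exact_mod_cast Nat.succ_ne_zero (j + 1)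
    simp only [Nat.succ_eq_add_one]
    push_cast
    generalize (n.choose j : ℂ) = a at *
    generalize (n.choose (j + 1) : ℂ) = b at *
    generalize (n.choose (j + 1 + 1) : ℂ) = c at *
    have hc : c = b * (n - (j + 1)) / (j + 2) := by field_simp; exact h2
    have hb : b = a * (n - j) / (j + 1) := by field_simp; exact h1
    rw [hc, hb]
    field_simp
    ring

lemma narayana_ne_zero (n : ℕ) (x : ℂ) (hx : ∀ r : ℝ, r ≤ 0 → x ≠ r) :
    ∑ k ∈ range (n + 1), ((n + 1).choose k : ℂ) * ((n + 1).choose (k + 1) : ℂ) * x ^ k ≠ 0 := by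
  have hx0 : x ≠ 0 := by simpa using hx 0 le_rfl
  set P : ℂ[X] := (X - C x) ^ (n + 1) * (X - C 1) ^ (n + 1) with hP
  have hdeg : P.natDegree = 2 * (n + 1) := by
    rw [hP, natDegree_mul (pow_ne_zero _ (X_sub_C_ne_zero _)) (pow_ne_zero _ (X_sub_C_ne_zero _)),
      natDegree_pow, natDegree_pow, natDegree_X_sub_C, natDegree_X_sub_C]
    ring
  have hmem := (roots_derivative_mem (convex_segment (𝕜 := ℝ) x (1 : ℂ)) P n (by omega) (by
    intro z hz
    simp [hP, sub_eq_zero] at hz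
    rcases hz with rfl | rfl
    · exact left_mem_segment _ _ _
    · exact right_mem_segment _ _ _)).2 0
  have hev : (derivative^[n] P).eval 0 = (-1) ^ n * (n.factorial : ℂ) * x *
      ∑ k ∈ range (n + 1), ((n + 1).choose k : ℂ) * ((n + 1).choose (k + 1) : ℂ) * x ^ k := by
    rw [hP, iterate_derivative_mul, eval_finsetSum, mul_sum]
    refine sum_congr rfl fun k hk => ?_
    have hk : k ≤ n := by simp at hk; omega
    rw [iterate_derivative_X_sub_pow, iterate_derivative_X_sub_pow]
    have e1 : n + 1 - (n - k) = k + 1 := by omega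
    have hc : (n.choose k : ℂ) * ((n + 1).descFactorial (n - k)) * ((n + 1).descFactorial k) =
        n.factorial * ((n + 1).choose k : ℂ) * ((n + 1).choose (k + 1) : ℂ) := by
      rw [Nat.descFactorial_eq_factorial_mul_choose, Nat.descFactorial_eq_factorial_mul_choose,
        ← Nat.choose_mul_factorial_mul_factorial hk,
        show (n + 1).choose (n - k) = (n + 1).choose (k + 1) by
          rw [← Nat.choose_symm (by omega : k + 1 ≤ n + 1)]; congr 1; omega]
      push_cast; ring
    have hpow : (-x) ^ (k + 1) * (-1 : ℂ) ^ (n + 1 - k) = (-1) ^ n * x * x ^ k := by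
      rw [neg_pow x, mul_right_comm, ← pow_add, show k + 1 + (n + 1 - k) = n + 2 by omega]
      ring
    simp only [nsmul_eq_mul, eval_mul, eval_natCast, eval_pow, eval_sub, eval_X, eval_C, zero_sub,
      e1]
    linear_combination (n.choose k : ℂ) * ((n + 1).descFactorial (n - k)) *
      ((n + 1).descFactorial k) * hpow + (-1) ^ n * x * x ^ k * hc
  intro h0
  rw [hev, h0, mul_zero] at hmem
  obtain ⟨a, b, ha, hb, hab, h⟩ := hmem rfl
  rcases ha.eq_or_lt with rfl | ha
  · simp at h hab; subst hab; simp at h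
  · apply hx (-(b / a)) (by have : 0 ≤ b / a := by positivity
                            linarith)
    have ha' : (a : ℂ) ≠ 0 := by exact_mod_cast ha.ne'
    simp at h
    push_cast
    field_simp
    linear_combination h

lemma semiFun_pow_ne_zero (n : ℕ) (y : ℂ) (hy : 0 < y.re) : semiFun ((C y + X) ^ n) ≠ 0 := by
  obtain ⟨d, hd⟩ := IsAlgClosed.exists_pow_nat_eq (y ^ 2 - 4) (n := 2) (by norm_num)
  set w : ℂ := (y + d) / 2 with hw
  have hw1 : w * (y - w) = 1 := by rw [hw]; linear_combination (-1 / 4 : ℂ) * hd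
  have hw0 : w ≠ 0 := by intro h; rw [h] at hw1; simp at hw1
  have hyw : y = w + 1 / w := by field_simp; linear_combination hw1
  have hx : ∀ r : ℝ, r ≤ 0 → w ^ 2 ≠ r := by
    intro r hr h
    have hre := congrArg Complex.re h
    have him := congrArg Complex.im h
    simp [pow_two] at hre him
    have hw_re : w.re = 0 := by
      rcases eq_or_ne w.im 0 with h0 | h0
      · rw [h0] at hre; nlinarith
      · have : w.re * w.im = 0 := by linarith
        exact (mul_eq_zero.1 this).resolve_right h0
    rw [hyw] at hy
    simp [hw_re] at hy
  have hne := narayana_ne_zero n (w ^ 2) hx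
  have hid := core_identity n (fun k => (n.choose k : ℂ))
    (fun k hk => by simp [Nat.choose_eq_zero_of_lt hk]) w hw0 1 (Multiset.replicate n (-1))
    (fun r hr => by rw [Multiset.eq_of_mem_replicate hr]; norm_num) (by
      simp only [Multiset.map_replicate, Multiset.prod_replicate]
      simp only [map_neg, map_one, sub_neg_eq_add, one_mul, add_pow, one_pow, mul_one]
      refine sum_congr rfl fun k _ => ?_
      rw [mul_comm]; simp)
  simp only [Multiset.map_replicate, Multiset.prod_replicate, neg_neg, div_one, one_pow,
    one_mul] at hid
  rw [← hyw] at hid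
  intro h0
  rw [h0, mul_zero] at hid
  apply hne
  calc _ = ∑ k ∈ range (n + 1), ((n : ℂ) + 1) *
        (logConcC (fun k => (n.choose k : ℂ)) k * (w ^ 2) ^ k) := by
        refine sum_congr rfl fun k _ => ?_
        rw [← choose_identity, logConcC]; ring
    _ = 0 := by rw [← mul_sum, hid, mul_zero]

lemma logConcC_ne_zero (n : ℕ) (a : ℕ → ℂ) (hs : ∀ k, n < k → a k = 0)
    (hroots : ∀ z : ℂ, (∑ k ∈ range (n + 1), C (a k) * X ^ k).eval z = 0 →
      ∃ r : ℝ, r < 0 ∧ z = (r : ℂ)) (x : ℂ) (hx : ∀ r : ℝ, r ≤ 0 → x ≠ r) :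
    ∑ k ∈ range (n + 1), logConcC a k * x ^ k ≠ 0 := by
  set P : ℂ[X] := ∑ k ∈ range (n + 1), C (a k) * X ^ k with hP
  have hP0 : P ≠ 0 := by
    intro h
    obtain ⟨r, hr, h1⟩ := hroots 1 (by rw [h]; simp)
    have : (1 : ℝ) = r := by exact_mod_cast h1
    linarith
  obtain ⟨ξ, hξ2, hξ⟩ : ∃ ξ : ℂ, ξ ^ 2 = x ∧ 0 < ξ.re := by
    obtain ⟨d, hd⟩ := IsAlgClosed.exists_pow_nat_eq x (n := 2) (by norm_num)
    rcases lt_trichotomy d.re 0 with h | h | h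
    · exact ⟨-d, by rw [neg_sq, hd], by simpa using h⟩
    · exfalso
      apply hx (-(d.im ^ 2)) (by nlinarith)
      rw [← hd]
      apply Complex.ext <;> simp [pow_two, h]
    · exact ⟨d, hd, h⟩
  have hξ0 : ξ ≠ 0 := by rintro rfl; simp at hξ
  have hr : ∀ r ∈ P.roots, ∃ t : ℝ, t < 0 ∧ r = (t : ℂ) := fun r hr =>
    hroots r ((mem_roots hP0).1 hr)
  have hr0 : ∀ r ∈ P.roots, r ≠ 0 := by
    intro r h
    obtain ⟨t, ht, rfl⟩ := hr r h
    exact_mod_cast ht.ne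
  have hid := core_identity n a hs ξ hξ0 P.leadingCoeff P.roots hr0
    (IsAlgClosed.splits P).eq_prod_roots
  rw [hξ2] at hid
  rw [hid]
  refine mul_ne_zero (mul_ne_zero (pow_ne_zero _ (leadingCoeff_ne_zero.2 hP0)) ?_) ?_
  · apply Multiset.prod_ne_zero
    intro h
    obtain ⟨r, h1, h2⟩ := Multiset.mem_map.1 h
    exact mul_ne_zero (neg_ne_zero.2 (hr0 r h1)) hξ0 h2
  · refine gws (P.roots.map fun r => ξ / (-r) + (-r) / ξ).card semiFun
      (by rw [semiFun_one]; exact one_ne_zero)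
      (fun y hy => semiFun_pow_ne_zero _ y hy) _ rfl ?_
    intro y hy
    obtain ⟨r, h1, rfl⟩ := Multiset.mem_map.1 hy
    obtain ⟨t, ht, rfl⟩ := hr r h1
    have e1 : (ξ / (-(t : ℂ))).re = ξ.re / (-t) := by
      rw [← Complex.ofReal_neg, Complex.div_ofReal_re]
    have e2 : ((-(t : ℂ)) / ξ).re = (-t) * (ξ.re / Complex.normSq ξ) := by
      rw [← Complex.ofReal_neg, div_eq_mul_inv, Complex.re_ofReal_mul, Complex.inv_re]
    rw [Complex.add_re, e1, e2]
    have ht' : 0 < -t := by linarith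
    have := Complex.normSq_pos.2 hξ0
    positivity

lemma exists_real_factor (s : Multiset ℂ) (hr : ∀ r ∈ s, ∃ t : ℝ, t < 0 ∧ r = (t : ℂ)) :
    ∃ R : ℝ[X], R.map Complex.ofRealHom = (s.map fun r => X - C r).prod ∧
      (∀ k, 0 ≤ R.coeff k) ∧ 0 < R.coeff 0 := by
  induction s using Multiset.induction_on with
  | empty =>
    refine ⟨1, by simp, fun k => ?_, by simp⟩
    rw [coeff_one]; split_ifs <;> norm_num
  | cons r s ih =>
    obtain ⟨R, h1, h2, h3⟩ := ih fun r h => hr r (by simp [h])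
    obtain ⟨t, ht, rfl⟩ := hr r (by simp)
    refine ⟨(X - C t) * R, by simp [h1], fun k => ?_, ?_⟩
    · rw [sub_mul, coeff_sub, coeff_C_mul]
      have := h2 k
      rcases k with _ | k
      · simp; nlinarith
      · rw [coeff_X_mul]; have := h2 k; nlinarith
    · rw [sub_mul, coeff_sub, coeff_C_mul]
      simp; nlinarith

/-- The hypothesis of the theorem. -/
def GoodSeq (n : ℕ) (a : ℕ → ℝ) : Prop :=
  (∀ k, n < k → a k = 0) ∧ ∀ z : ℂ,
      (∑ k ∈ range (n + 1), C (a k : ℂ) * X ^ k).eval z = 0 → ∃ r : ℝ, r < 0 ∧ z = (r : ℂ)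

lemma logConcC_ofReal (a : ℕ → ℝ) (k : ℕ) :
    logConcC (fun k => (a k : ℂ)) k = (logConcOp a k : ℝ) := by
  rw [logConcC, logConcOp]; push_cast; split_ifs <;> simp

lemma GoodSeq.zero_ne {n : ℕ} {a : ℕ → ℝ} (h : GoodSeq n a) : a 0 ≠ 0 := by
  intro h0
  obtain ⟨r, hr, h1⟩ := h.2 0 (by rw [eval_finsetSum, sum_range_succ']; simp [h0])
  have : (0 : ℝ) = r := by exact_mod_cast h1
  linarith

lemma logConcOp_zero (a : ℕ → ℝ) : logConcOp a 0 = a 0 ^ 2 := by simp [logConcOp]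

lemma GoodSeq.step {n : ℕ} {a : ℕ → ℝ} (h : GoodSeq n a) : GoodSeq n (logConcOp a) := by
  refine ⟨fun k hk => ?_, fun z hz => ?_⟩
  · rw [logConcOp, h.1 k hk, h.1 (k + 1) (by omega)]; simp
  · by_contra! hcon
    have hz' : ∑ k ∈ range (n + 1), logConcC (fun k => (a k : ℂ)) k * z ^ k = 0 := by
      rw [← hz, eval_finsetSum]
      refine sum_congr rfl fun k _ => ?_
      rw [logConcC_ofReal]; simp
    refine logConcC_ne_zero n (fun k => (a k : ℂ)) (fun k hk => by simp [h.1 k hk]) h.2 z ?_ hz'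
    intro r hr
    rcases hr.eq_or_lt with rfl | hr
    · rintro rfl
      rw [sum_range_succ', logConcC_ofReal, logConcOp_zero] at hz'
      simp at hz'
      exact h.zero_ne hz'
    · exact hcon r hr

lemma GoodSeq.nonneg {n : ℕ} {a : ℕ → ℝ} (h : GoodSeq n a) (h0 : 0 < a 0) (k : ℕ) : 0 ≤ a k := by
  set P : ℂ[X] := ∑ k ∈ range (n + 1), C (a k : ℂ) * X ^ k with hP
  have hcoeff : ∀ k, P.coeff k = a k := by
    intro k
    simp only [hP, finsetSum_coeff, coeff_C_mul, coeff_X_pow, mul_ite, mul_one, mul_zero,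
      Finset.sum_ite_eq, mem_range]
    split_ifs with hk
    · rfl
    · rw [h.1 k (by omega)]; simp
  have hP0 : P ≠ 0 := by
    intro hz
    have := hcoeff 0
    rw [hz] at this
    simp at this
    exact h0.ne (by exact_mod_cast this)
  obtain ⟨R, h1, h2, h3⟩ := exists_real_factor P.roots fun r hr => h.2 r ((mem_roots hP0).1 hr)
  have hfac := (IsAlgClosed.splits P).eq_prod_roots
  rw [← h1] at hfac
  have hc : ∀ k, (a k : ℂ) = P.leadingCoeff * (R.coeff k : ℂ) := by
    intro k
    rw [← hcoeff k]
    conv_lhs => rw [hfac]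
    rw [coeff_C_mul, coeff_map]; rfl
  have e : a k * R.coeff 0 = a 0 * R.coeff k := by
    have : (a k : ℂ) * R.coeff 0 = a 0 * R.coeff k := by rw [hc k, hc 0]; ring
    exact_mod_cast this
  have : 0 ≤ a k * R.coeff 0 := by rw [e]; exact mul_nonneg h0.le (h2 k)
  exact nonneg_of_mul_nonneg_left this h3

theorem infinitely_log_concave_of_real_neg_rooted (n : ℕ) (a : ℕ → ℝ)
    (hsupp : ∀ k, n < k → a k = 0)
    (hroots : ∀ z : ℂ,
      Polynomial.aeval z (∑ k ∈ Finset.range (n + 1), Polynomial.C (a k) * Polynomial.X ^ k) = 0 →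
      ∃ r : ℝ, r < 0 ∧ z = (r : ℂ)) :
    ∀ j : ℕ, 1 ≤ j → ∀ k : ℕ, 0 ≤ (logConcOp^[j] a) k := by
  have hgood : GoodSeq n a := by
    refine ⟨hsupp, fun z hz => hroots z ?_⟩
    rw [← hz, map_sum, eval_finsetSum]
    refine sum_congr rfl fun k _ => ?_
    simp
  have hiter : ∀ j, GoodSeq n (logConcOp^[j] a) := by
    intro j
    induction j with
    | zero => exact hgood
    | succ j ih => rw [Function.iterate_succ_apply']; exact ih.step
  intro j hj k
  obtain ⟨i, rfl⟩ : ∃ i, j = i + 1 := ⟨j - 1, by omega⟩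
  refine (hiter (i + 1)).nonneg ?_ k
  rw [Function.iterate_succ_apply', logConcOp_zero]
  have := (hiter i).zero_ne
  positivity
end
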